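/- Let N ≥ 1, let A be a constant N×N complex matrix, and let B : ℝ → (N×2 complex matrices) and 𝕏 : ℝ → (N×N complex matrices) be continuously differentiable, with 𝕏(x) Hermitian and invertible for all x, satisfying for all x: (i) d/dx (B σ₁) + A B σ₂ + B γ = 0; (ii) A 𝕏 + 𝕏 A* + B σ₁ B* = 0; (iii) d𝕏/dx = B σ₂ B*. Define γ_*(x) := γ + σ₂ B(x)* 𝕏(x)⁻¹ B(x) σ₁ − σ₁ B(x)* 𝕏(x)⁻¹ B(x) σ₂. Then the 2×N matrix-valued function B* 𝕏⁻¹ satisfies σ₁ · d/dx (B* 𝕏⁻¹) = σ₂ (B* 𝕏⁻¹) A + γ_* (B* 𝕏⁻¹) for all x. -/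

import Mathlib

open Matrix Complex

noncomputable section

/-- The fixed 2×2 matrix σ₁ = [[0,1],[1,0]]. -/
def sigma1 : Matrix (Fin 2) (Fin 2) ℂ := !![0, 1; 1, 0]

/-- The fixed 2×2 matrix σ₂ = [[1,0],[0,0]]. -/
def sigma2 : Matrix (Fin 2) (Fin 2) ℂ := !![1, 0; 0, 0]

/-- The fixed 2×2 matrix γ = [[0,0],[0,i]]. -/
def gammaM : Matrix (Fin 2) (Fin 2) ℂ := !![0, 0; 0, Complex.I]

attribute [local instance] Matrix.normedAddCommGroup Matrix.normedSpace

section InvHelper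

attribute [-instance] Matrix.normedAddCommGroup Matrix.normedSpace
attribute [local instance] Matrix.linftyOpNormedRing Matrix.linftyOpNormedAlgebra

theorem inv_entry_deriv {N : ℕ} (X : ℝ → Matrix (Fin N) (Fin N) ℂ) (X' : Matrix (Fin N) (Fin N) ℂ)
    (x : ℝ) (hu : IsUnit (X x))
    (h : ∀ i j, HasDerivAt (fun t => X t i j) (X' i j) x) (i j : Fin N) :
    HasDerivAt (fun t => (X t)⁻¹ i j) ((-((X x)⁻¹ * X' * (X x)⁻¹)) i j) x := by
  have hX : HasDerivAt X X' x :=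
    hasDerivAt_pi.2 fun i => hasDerivAt_pi.2 fun j => h i j
  obtain ⟨u, hu⟩ := hu
  have hf := hasFDerivAt_ringInverse (𝕜 := ℝ) u
  rw [hu] at hf
  have hc := hf.comp_hasDerivAt x hX
  have h2 : (u⁻¹ : (Matrix (Fin N) (Fin N) ℂ)ˣ).val = (X x)⁻¹ := by
    rw [← hu, Matrix.coe_units_inv]
  have h3 : HasDerivAt (fun t => (X t)⁻¹) (-((X x)⁻¹ * X' * (X x)⁻¹)) x := by
    simp only [Matrix.nonsing_inv_eq_ringInverse] at h2 ⊢
    simp [h2, Function.comp_def] at hc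
    exact hc
  exact hasDerivAt_pi.1 (hasDerivAt_pi.1 h3 i) j

end InvHelper

theorem matrix_hasDerivAt_iff {m n : ℕ} {f : ℝ → Matrix (Fin m) (Fin n) ℂ}
    {f' : Matrix (Fin m) (Fin n) ℂ} {x : ℝ} :
    HasDerivAt f f' x ↔ ∀ i j, HasDerivAt (fun t => f t i j) (f' i j) x := by
  constructor
  · intro h i j
    exact hasDerivAt_pi.1 (hasDerivAt_pi.1 h i) j
  · intro h
    exact hasDerivAt_pi.2 fun i => hasDerivAt_pi.2 fun j => h i j

theorem matrix_hasDerivAt_mul {l m n : ℕ} {f : ℝ → Matrix (Fin l) (Fin m) ℂ}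
    {g : ℝ → Matrix (Fin m) (Fin n) ℂ}
    {f' : Matrix (Fin l) (Fin m) ℂ} {g' : Matrix (Fin m) (Fin n) ℂ} {x : ℝ}
    (hf : HasDerivAt f f' x) (hg : HasDerivAt g g' x) :
    HasDerivAt (fun t => f t * g t) (f' * g x + f x * g') x := by
  rw [matrix_hasDerivAt_iff] at *
  intro i j
  simp only [Matrix.mul_apply, Matrix.add_apply, ← Finset.sum_add_distrib]
  exact HasDerivAt.fun_sum fun k _ => (hf i k).mul (hg k j)

theorem matrix_hasDerivAt_conjTranspose {m n : ℕ} {f : ℝ → Matrix (Fin m) (Fin n) ℂ}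
    {f' : Matrix (Fin m) (Fin n) ℂ} {x : ℝ} (hf : HasDerivAt f f' x) :
    HasDerivAt (fun t => (f t)ᴴ) (f'ᴴ) x := by
  rw [matrix_hasDerivAt_iff] at *
  intro i j
  exact (hf j i).star

theorem sigma1_conj : sigma1ᴴ = sigma1 := by
  ext i j; fin_cases i <;> fin_cases j <;> simp [sigma1]

theorem sigma2_conj : sigma2ᴴ = sigma2 := by
  ext i j; fin_cases i <;> fin_cases j <;> simp [sigma2]

theorem gammaM_conj : gammaMᴴ = -gammaM := by
  ext i j; fin_cases i <;> fin_cases j <;> simp [gammaM]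

/-- for a Sturm–Liouville vessel, the function `B* 𝕏⁻¹` satisfies
`σ₁ d/dx (B* 𝕏⁻¹) = σ₂ (B* 𝕏⁻¹) A + γ_* (B* 𝕏⁻¹)`, where
`γ_* = γ + σ₂ B* 𝕏⁻¹ B σ₁ − σ₁ B* 𝕏⁻¹ B σ₂`. -/
theorem BstarXinv_ODE (N : ℕ) (hN : 1 ≤ N)
    (A : Matrix (Fin N) (Fin N) ℂ)
    (B : ℝ → Matrix (Fin N) (Fin 2) ℂ)
    (X : ℝ → Matrix (Fin N) (Fin N) ℂ)
    (hBsmooth : ContDiff ℝ 1 B) (hXsmooth : ContDiff ℝ 1 X)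
    (hherm : ∀ x, (X x).IsHermitian) (hinv : ∀ x, IsUnit (X x))
    (h1 : ∀ x, HasDerivAt (fun x' => B x' * sigma1)
      (-(A * B x * sigma2 + B x * gammaM)) x)
    (h2 : ∀ x, A * X x + X x * Aᴴ + B x * sigma1 * (B x)ᴴ = 0)
    (h3 : ∀ x, HasDerivAt X (B x * sigma2 * (B x)ᴴ) x)
    (gammaStar : ℝ → Matrix (Fin 2) (Fin 2) ℂ)
    (hgs : ∀ x, gammaStar x = gammaM + sigma2 * (B x)ᴴ * (X x)⁻¹ * B x * sigma1
      - sigma1 * (B x)ᴴ * (X x)⁻¹ * B x * sigma2) :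
    ∀ x, HasDerivAt (fun x' => sigma1 * ((B x')ᴴ * (X x')⁻¹))
      (sigma2 * ((B x)ᴴ * (X x)⁻¹) * A + gammaStar x * ((B x)ᴴ * (X x)⁻¹)) x := by
  intro x
  have hu : IsUnit (X x).det := (Matrix.isUnit_iff_isUnit_det _).1 (hinv x)
  have hI : HasDerivAt (fun t => (X t)⁻¹)
      (-((X x)⁻¹ * (B x * sigma2 * (B x)ᴴ) * (X x)⁻¹)) x :=
    matrix_hasDerivAt_iff.2
      (inv_entry_deriv X _ x (hinv x) (matrix_hasDerivAt_iff.1 (h3 x)))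
  have hB := matrix_hasDerivAt_conjTranspose (h1 x)
  have hM := matrix_hasDerivAt_mul hB hI
  simp only [Matrix.conjTranspose_mul, Matrix.conjTranspose_neg, Matrix.conjTranspose_add,
    sigma1_conj, sigma2_conj, gammaM_conj] at hM
  have key : Aᴴ * (X x)⁻¹ = -((X x)⁻¹ * A) - (X x)⁻¹ * B x * sigma1 * (B x)ᴴ * (X x)⁻¹ := by
    have h := congrArg (fun M => (X x)⁻¹ * M * (X x)⁻¹) (h2 x)
    simp only [Matrix.mul_add, Matrix.add_mul, Matrix.mul_zero, Matrix.zero_mul] at h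
    rw [← Matrix.mul_assoc (X x)⁻¹ A, Matrix.mul_nonsing_inv_cancel_right _ _ hu,
      Matrix.nonsing_inv_mul_cancel_left _ _ hu] at h
    simp only [← Matrix.mul_assoc] at h
    rw [← sub_eq_zero, ← h]
    abel
  have hval : sigma2 * ((B x)ᴴ * (X x)⁻¹) * A + gammaStar x * ((B x)ᴴ * (X x)⁻¹)
      = -(sigma2 * ((B x)ᴴ * Aᴴ) + -gammaM * (B x)ᴴ) * (X x)⁻¹
        + sigma1 * (B x)ᴴ * -((X x)⁻¹ * (B x * sigma2 * (B x)ᴴ) * (X x)⁻¹) := by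
    have e : sigma2 * ((B x)ᴴ * Aᴴ) * (X x)⁻¹ = sigma2 * ((B x)ᴴ * (Aᴴ * (X x)⁻¹)) := by
      simp only [Matrix.mul_assoc]
    rw [hgs, Matrix.neg_mul, Matrix.add_mul (sigma2 * ((B x)ᴴ * Aᴴ)), e, key]
    simp only [Matrix.mul_add, Matrix.add_mul, Matrix.mul_sub, Matrix.sub_mul, Matrix.neg_mul,
      Matrix.mul_neg, Matrix.mul_assoc]
    abel
  rw [hval]
  simpa only [Matrix.mul_assoc] using hM

end
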